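/- arXiv:1401.1393 — 7 statements merged into one kernel-verified Lean document; each statement's English description precedes it below -/
import Mathlib

section
/- Let S be a dyadic subbase of X. Then for every x ∈ X, the set dom(x̃) = {k ∈ ℕ : x̃(k) ≠ ⊥} is infinite; equivalently, X̃ is contained in the set of limit (non-compact) elements of 𝕋^ω. (Proposition 2.3(2)) -/
open Set Topology TopologicalSpace

/-- The three-element set 𝕋 = {0, 1, ⊥}. `digit b` is a digit (0 or 1), `bot` is ⊥. -/
inductive TT where
  | bot : TT
  | digit : Bool → TT
  deriving DecidableEq

/-- The topology on 𝕋 whose open sets are ∅, {0}, {1}, {0,1}, 𝕋. -/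
instance : TopologicalSpace TT :=
  generateFrom {{TT.digit false}, {TT.digit true}}

/-- The pointwise order ⊑ on 𝕋^ω (⊥ ⊑ 0, ⊥ ⊑ 1, digits incomparable). -/
def TLe (p q : ℕ → TT) : Prop := ∀ k (b : Bool), p k = TT.digit b → q k = TT.digit b

/-- Compatibility in 𝕋^ω: existence of a common upper bound. -/
def TCompat (p q : ℕ → TT) : Prop := ∃ r, TLe p r ∧ TLe q r

/-- dom(p) = the set of positions where p has a digit. -/
def Tdom (p : ℕ → TT) : Set ℕ := {k | p k ≠ TT.bot}

/-- p is a finite bottomed sequence (an element of 𝕋^*). -/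
def TFin (p : ℕ → TT) : Prop := (Tdom p).Finite

/-- The truncation p|_n. -/
def trunc (p : ℕ → TT) (n : ℕ) : ℕ → TT := fun k => if k < n then p k else TT.bot

/-- The pointwise least upper bound of two (compatible) bottomed sequences. -/
def tsup (d e : ℕ → TT) : ℕ → TT := fun k => if d k = TT.bot then e k else d k

/-- A dyadic subbase of X: a family of regular open sets, pairwise exteriors,
forming a subbase of the topology of X. -/
structure DyadicSubbase (X : Type*) [t : TopologicalSpace X] where
  S : ℕ → Bool → Set X
  regOpen : ∀ n a, S n a = interior (closure (S n a))
  compl : ∀ n, S n true = (closure (S n false))ᶜ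
  subbase : generateFrom {U | ∃ n a, U = S n a} = t

variable {X : Type*} [TopologicalSpace X]

open Classical in
/-- The embedding φ_S : X → 𝕋^ω. -/
noncomputable def phi (D : DyadicSubbase X) (x : X) : ℕ → TT := fun n =>
  if x ∈ D.S n false then TT.digit false
  else if x ∈ D.S n true then TT.digit true
  else TT.bot

/-- S(p) = ⋂_{k ∈ dom p} S_{k, p(k)}. -/
def Sint (D : DyadicSubbase X) (p : ℕ → TT) : Set X :=
  {x | ∀ k (b : Bool), p k = TT.digit b → x ∈ D.S k b}

/-- S̄(p) = ⋂_{k ∈ dom p} cl(S_{k, p(k)}). -/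
def SbarInt (D : DyadicSubbase X) (p : ℕ → TT) : Set X :=
  {x | ∀ k (b : Bool), p k = TT.digit b → x ∈ closure (D.S k b)}

/-- S is a proper dyadic subbase: cl(S(e)) = S̄(e) for all finite bottomed e. -/
def IsProperDS (D : DyadicSubbase X) : Prop :=
  ∀ e, TFin e → closure (Sint D e) = SbarInt D e

/-- ↑X̃ = {p : x̃ ⊑ p for some x}. -/
def upX (D : DyadicSubbase X) : Set (ℕ → TT) := {p | ∃ x, TLe (phi D x) p}

/-- 2^ω, the bottom-free sequences. -/
def twoOmega : Set (ℕ → TT) := {p | ∀ k, p k ≠ TT.bot}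

/-- K_S = {x̃|_m : x ∈ X, m ∈ ℕ}. -/
def KS (D : DyadicSubbase X) : Set (ℕ → TT) := {e | ∃ x m, e = trunc (phi D x) m}

/-- K̂_S = {p|_m : p ∈ ↑X̃, m ∈ ℕ}. -/
def KhatS (D : DyadicSubbase X) : Set (ℕ → TT) := {e | ∃ p ∈ upX D, ∃ m, e = trunc p m}

/-- I is an ideal of the subposet K of 𝕋^ω. -/
def IsIdealOf (K I : Set (ℕ → TT)) : Prop :=
  I ⊆ K ∧ I.Nonempty ∧ (∀ d ∈ I, ∀ e ∈ I, ∃ f ∈ I, TLe d f ∧ TLe e f) ∧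
    (∀ d ∈ K, ∀ e ∈ I, TLe d e → d ∈ I)

/-- p is the pointwise least upper bound of the set I in 𝕋^ω. -/
def IsSupOf (I : Set (ℕ → TT)) (p : ℕ → TT) : Prop :=
  ∀ k (b : Bool), p k = TT.digit b ↔ ∃ e ∈ I, e k = TT.digit b

/-- D_S ⊆ 𝕋^ω: least upper bounds of ideals of K_S. -/
def DS (D : DyadicSubbase X) : Set (ℕ → TT) := {p | ∃ I, IsIdealOf (KS D) I ∧ IsSupOf I p}

/-- D̂_S ⊆ 𝕋^ω: least upper bounds of ideals of K̂_S. -/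
def DhatS (D : DyadicSubbase X) : Set (ℕ → TT) := {p | ∃ I, IsIdealOf (KhatS D) I ∧ IsSupOf I p}

/-- The limit (non-compact) elements of a subdomain E of 𝕋^ω:
those with infinite domain. -/
def limitsOf (E : Set (ℕ → TT)) : Set (ℕ → TT) := {p ∈ E | (Tdom p).Infinite}

/-- The minimal elements of a subset A of 𝕋^ω. -/
def minOf (A : Set (ℕ → TT)) : Set (ℕ → TT) := {p ∈ A | ∀ q ∈ A, TLe q p → q = p}

/-- q is an immediate successor of p in the subposet K of 𝕋^ω. -/
def ImmSucc (K : Set (ℕ → TT)) (p q : ℕ → TT) : Prop :=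
  p ∈ K ∧ q ∈ K ∧ TLe p q ∧ p ≠ q ∧ ¬∃ r ∈ K, TLe p r ∧ p ≠ r ∧ TLe r q ∧ r ≠ q

/-- A Hausdorff space is adhesive if it has at least two points and the closures
of any two nonempty open sets intersect. -/
def Adhesive (Y : Type*) [TopologicalSpace Y] : Prop :=
  (∃ y z : Y, y ≠ z) ∧
    ∀ U V : Set Y, IsOpen U → IsOpen V → U.Nonempty → V.Nonempty →
      (closure U ∩ closure V).Nonempty

/-- A space is strongly nonadhesive if every open subspace is nonadhesive. -/
def StronglyNonadhesive (Y : Type*) [TopologicalSpace Y] : Prop :=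
  ∀ U : Set Y, IsOpen U → ¬ Adhesive U
/-- Proposition 2.3(2): dom(x̃) is infinite, i.e. X̃ ⊆ L(𝕋^ω). -/
theorem stmt_1 {X : Type*} [TopologicalSpace X] [T2Space X] [SecondCountableTopology X]
    (D : DyadicSubbase X) (x : X) :
    (Tdom (phi D x)).Infinite := by
  classical
  intro hfin
  have hopen : ∀ n a, IsOpen (D.S n a) := fun n a => by
    rw [D.regOpen n a]; exact isOpen_interior
  have hmem : ∀ n a, x ∈ D.S n a → n ∈ Tdom (phi D x) := by
    intro n a h
    show phi D x n ≠ TT.bot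
    unfold phi
    split_ifs with h1 h2
    · simp
    · simp
    · cases a
      · exact absurd h h1
      · exact absurd h h2
  have hTfin : {s | x ∈ s ∧ s ∈ {U | ∃ n a, U = D.S n a}}.Finite := by
    refine ((hfin.prod (Set.finite_univ (α := Bool))).image (fun p => D.S p.1 p.2)).subset ?_
    rintro s ⟨hx, n, a, rfl⟩
    exact ⟨(n, a), ⟨hmem n a hx, Set.mem_univ _⟩, rfl⟩
  have hU : IsOpen (⋂₀ {s | x ∈ s ∧ s ∈ {U | ∃ n a, U = D.S n a}}) := by
    refine hTfin.isOpen_sInter ?_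
    rintro s ⟨-, n, a, rfl⟩
    exact hopen n a
  have hnh : 𝓝 x = ⨅ s ∈ {s | x ∈ s ∧ s ∈ {U | ∃ n a, U = D.S n a}}, Filter.principal s := by
    have h := @nhds_generateFrom X {U | ∃ n a, U = D.S n a} x
    rw [D.subbase] at h
    exact h
  have hle : Filter.principal (⋂₀ {s | x ∈ s ∧ s ∈ {U | ∃ n a, U = D.S n a}}) ≤ 𝓝 x := by
    rw [hnh]
    refine le_iInf₂ fun s hs => ?_
    exact Filter.principal_mono.2 (Set.sInter_subset_of_mem hs)
  have hsub : ∀ y ∈ (⋂₀ {s | x ∈ s ∧ s ∈ {U | ∃ n a, U = D.S n a}}), y = x := by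
    intro y hy
    by_contra hne
    have h1 : ({y}ᶜ : Set X) ∈ 𝓝 x := isOpen_compl_singleton.mem_nhds (Ne.symm hne)
    exact hle h1 hy rfl
  have hdom : Tdom (phi D x) = Set.univ := by
    refine Set.eq_univ_of_forall fun n => ?_
    by_cases h : x ∈ closure (D.S n false)
    · obtain ⟨y, hyU, hyS⟩ := mem_closure_iff.1 h _ hU (fun s hs => hs.1)
      rw [hsub y hyU] at hyS
      exact hmem n false hyS
    · exact hmem n true (by rw [D.compl]; exact h)
  rw [hdom] at hfin
  exact Set.infinite_univ hfin
end

section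
/- Let S be a proper dyadic subbase of X, let x ∈ X, and let p ∈ 𝕋^ω with x̃ ⊑ p. Then the family {S(e) : e ∈ 𝕋^*, e ⊑ p} is a filter base on X (in particular S(e) ≠ ∅ for every finite bottomed sequence e ⊑ p), and the filter on X that it generates converges to x. (Proposition 2.5(1)) -/
open Set Topology TopologicalSpace

variable {X : Type*} [TopologicalSpace X]

theorem aux_phi {X : Type*} [TopologicalSpace X] (D : DyadicSubbase X) (x : X) (k : ℕ) (b : Bool)
    (h : x ∈ D.S k b) : phi D x k = TT.digit b := by
  cases b with
  | false => simp [phi, h]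
  | true =>
    have h2 : x ∉ D.S k false := by
      intro h3
      rw [D.compl] at h
      exact h (subset_closure h3)
    simp [phi, h, h2]

theorem aux_cl {X : Type*} [TopologicalSpace X] (D : DyadicSubbase X) (x : X) (k : ℕ) (b : Bool)
    (h : x ∉ D.S k (!b)) : x ∈ closure (D.S k b) := by
  cases b with
  | false =>
    by_contra hc
    apply h
    show x ∈ D.S k true
    rw [D.compl]
    exact hc
  | true =>
    rw [D.compl, closure_compl, ← D.regOpen]
    exact h

theorem aux_sup {X : Type*} [TopologicalSpace X] (D : DyadicSubbase X) (p d e : ℕ → TT)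
    (hd : TFin d) (hdp : TLe d p) (he : TFin e) (hep : TLe e p) :
    ∃ f, TFin f ∧ TLe f p ∧ Sint D f ⊆ Sint D d ∩ Sint D e := by
  refine ⟨tsup d e, ?_, ?_, ?_⟩
  · refine (hd.union he).subset ?_
    intro k hk
    by_cases h : d k = TT.bot
    · right
      simpa [Tdom, tsup, h] using hk
    · left
      exact h
  · intro k b hk
    by_cases h : d k = TT.bot
    · apply hep
      simpa [tsup, h] using hk
    · apply hdp
      simpa [tsup, h] using hk
  · intro y hy
    constructor
    · intro k b hk
      apply hy
      simp [tsup, hk]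
    · intro k b hk
      apply hy
      by_cases h : d k = TT.bot
      · simp [tsup, h, hk]
      · obtain ⟨c, hc⟩ : ∃ c, d k = TT.digit c := by
          cases hh : d k with
          | bot => exact absurd hh h
          | digit c => exact ⟨c, rfl⟩
        have h1 := hdp k c hc
        have h2 := hep k b hk
        rw [h1] at h2
        simp [tsup, hc, h2]

theorem aux_nhds {X : Type*} [TopologicalSpace X] (D : DyadicSubbase X) (x : X) (p : ℕ → TT)
    (hp : TLe (phi D x) p) (U : Set X)
    (hU : GenerateOpen {U | ∃ n a, U = D.S n a} U) (hx : x ∈ U) :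
    ∃ e, TFin e ∧ TLe e p ∧ Sint D e ⊆ U := by
  induction hU with
  | basic s hs =>
    obtain ⟨n, a, rfl⟩ := hs
    have hpn := hp n a (aux_phi D x n a hx)
    refine ⟨fun k => if k = n then TT.digit a else TT.bot, ?_, ?_, ?_⟩
    · refine (Set.finite_singleton n).subset ?_
      intro k hk
      by_contra h
      have h' : k ≠ n := h
      simp [Tdom, h'] at hk
    · intro k b hk
      by_cases h : k = n
      · subst h
        simp at hk
        rw [← hk]; exact hpn
      · simp [h] at hk
    · intro y hy
      exact hy n a (by simp)
  | univ =>
    refine ⟨fun _ => TT.bot, ?_, ?_, Set.subset_univ _⟩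
    · simp [TFin, Tdom]
    · intro k b hk
      simp at hk
  | inter s t _ _ ihs iht =>
    obtain ⟨d, hd, hdp, hds⟩ := ihs hx.1
    obtain ⟨e, he, hep, het⟩ := iht hx.2
    obtain ⟨f, hf, hfp, hfs⟩ := aux_sup D p d e hd hdp he hep
    exact ⟨f, hf, hfp, hfs.trans (Set.inter_subset_inter hds het)⟩
  | sUnion A _ ih =>
    obtain ⟨s, hs, hxs⟩ := hx
    obtain ⟨e, he, hep, hes⟩ := ih s hs hxs
    exact ⟨e, he, hep, hes.trans (Set.subset_sUnion_of_mem hs)⟩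

/-- Proposition 2.5(1): for x̃ ⊑ p, the family {S(e) : e ∈ 𝕋^*, e ⊑ p} is a
filter base converging to x. -/
theorem stmt_2 {X : Type*} [TopologicalSpace X] [T2Space X] [SecondCountableTopology X]
    (D : DyadicSubbase X) (hD : IsProperDS D) (x : X) (p : ℕ → TT)
    (hp : TLe (phi D x) p) :
    (∀ e, TFin e → TLe e p → (Sint D e).Nonempty) ∧
    (∀ d e, TFin d → TLe d p → TFin e → TLe e p →
      ∃ f, TFin f ∧ TLe f p ∧ Sint D f ⊆ Sint D d ∩ Sint D e) ∧
    (∀ U ∈ nhds x, ∃ e, TFin e ∧ TLe e p ∧ Sint D e ⊆ U) := by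
  refine ⟨?_, fun d e hd hdp he hep => aux_sup D p d e hd hdp he hep, ?_⟩
  · intro e he hep
    rw [← closure_nonempty_iff, hD e he]
    refine ⟨x, fun k b hk => aux_cl D x k b fun h => ?_⟩
    have h1 := hp k _ (aux_phi D x k _ h)
    rw [hep k b hk] at h1
    cases b <;> simp at h1
  · intro U hU
    obtain ⟨V, hVU, hV, hxV⟩ := mem_nhds_iff.1 hU
    rw [← D.subbase] at hV
    obtain ⟨e, he, hep, h⟩ := aux_nhds D x p hp V hV hxV
    exact ⟨e, he, hep, h.trans hVU⟩
end

section
/- Let S be a dyadic subbase of X. If d, e ∈ K̂_S are compatible in 𝕋^ω, then their least upper bound d ⊔ e in 𝕋^ω belongs to K̂_S; hence K̂_S is a conditional upper semilattice with least element, and consequently D̂_S is bounded complete: every pair of elements of D̂_S having an upper bound in D̂_S has a least upper bound in D̂_S. (Proposition 4.4) -/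
open Set Topology TopologicalSpace

variable {X : Type*} [TopologicalSpace X]

lemma aux_le_left (d e : ℕ → TT) : TLe d (tsup d e) := by
  intro k b h; simp [tsup, h]

lemma aux_le_right {d e r : ℕ → TT} (h1 : TLe d r) (h2 : TLe e r) : TLe e (tsup d e) := by
  intro k b h
  have a := h2 k b h
  cases hd : d k with
  | bot => simp [tsup, hd, h]
  | digit c =>
    have c1 := h1 k c hd
    simp [tsup, hd]
    rw [a] at c1
    simpa using c1.symm

lemma aux_sup_le {d e r : ℕ → TT} (h1 : TLe d r) (h2 : TLe e r) : TLe (tsup d e) r := by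
  intro k b h
  unfold tsup at h
  split_ifs at h
  · exact h2 k b h
  · exact h1 k b h

lemma aux_trans {d e r : ℕ → TT} (h1 : TLe d e) (h2 : TLe e r) : TLe d r :=
  fun k b h => h2 k b (h1 k b h)

lemma aux_antisymm {d e : ℕ → TT} (h1 : TLe d e) (h2 : TLe e d) : d = e := by
  funext k
  cases hd : d k with
  | digit c => exact (h1 k c hd).symm
  | bot =>
    cases he : e k with
    | bot => rfl
    | digit c => have := h2 k c he; simp [hd] at this

lemma aux_comm {d e r : ℕ → TT} (h1 : TLe d r) (h2 : TLe e r) : tsup d e = tsup e d :=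
  aux_antisymm (aux_sup_le (aux_le_right h2 h1) (aux_le_left _ _))
    (aux_sup_le (aux_le_right h1 h2) (aux_le_left _ _))

lemma aux_key {X : Type*} [TopologicalSpace X] (D : DyadicSubbase X) {p q r : ℕ → TT} {m n : ℕ}
    (hmn : m ≤ n) (hq : q ∈ upX D)
    (h1 : TLe (trunc p m) r) (h2 : TLe (trunc q n) r) :
    tsup (trunc p m) (trunc q n) ∈ KhatS D := by
  obtain ⟨y, hy⟩ := hq
  refine ⟨fun k => if k < n then tsup (trunc p m) (trunc q n) k else q k, ⟨y, ?_⟩, n, ?_⟩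
  · intro k b h
    have hqk := hy k b h
    by_cases hk : k < n
    · simp only [hk, if_true]
      exact aux_le_right h1 h2 k b (by simp [trunc, hk, hqk])
    · simp [hk, hqk]
  · funext k
    by_cases hk : k < n
    · simp [trunc, hk]
    · have : ¬ k < m := by omega
      simp [trunc, tsup, hk, this]

lemma aux_part1 {X : Type*} [TopologicalSpace X] (D : DyadicSubbase X) :
    ∀ d ∈ KhatS D, ∀ e ∈ KhatS D, TCompat d e → tsup d e ∈ KhatS D := by
  rintro _ ⟨p, hp, m, rfl⟩ _ ⟨q, hq, n, rfl⟩ ⟨r, h1, h2⟩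
  rcases le_total m n with h | h
  · exact aux_key D h hq h1 h2
  · rw [aux_comm h1 h2]
    exact aux_key D h hp h2 h1

/-- Proposition 4.4: K̂_S is closed under least upper bounds of compatible pairs
(so it is a cusl), and consequently D̂_S is bounded complete. -/
theorem stmt_8 {X : Type*} [TopologicalSpace X] [T2Space X] [SecondCountableTopology X]
    (D : DyadicSubbase X) :
    (∀ d ∈ KhatS D, ∀ e ∈ KhatS D, TCompat d e → tsup d e ∈ KhatS D) ∧
    (∀ p ∈ DhatS D, ∀ q ∈ DhatS D, (∃ r ∈ DhatS D, TLe p r ∧ TLe q r) →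
      ∃ s ∈ DhatS D, TLe p s ∧ TLe q s ∧
        ∀ r ∈ DhatS D, TLe p r → TLe q r → TLe s r) := by
  refine ⟨aux_part1 D, ?_⟩
  rintro p ⟨I, ⟨hIK, ⟨i0, hi0⟩, hId, hIl⟩, hIs⟩ q ⟨J, ⟨hJK, ⟨j0, hj0⟩, hJd, hJl⟩, hJs⟩ ⟨r, -, hpr, hqr⟩
  have hIp : ∀ d ∈ I, TLe d p := fun d hd k b h => (hIs k b).2 ⟨d, hd, h⟩
  have hJq : ∀ d ∈ J, TLe d q := fun d hd k b h => (hJs k b).2 ⟨d, hd, h⟩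
  have hIr : ∀ d ∈ I, TLe d r := fun d hd => aux_trans (hIp d hd) hpr
  have hJr : ∀ d ∈ J, TLe d r := fun d hd => aux_trans (hJq d hd) hqr
  have hK : ∀ d ∈ I, ∀ e ∈ J, tsup d e ∈ KhatS D := fun d hd e he =>
    aux_part1 D d (hIK hd) e (hJK he) ⟨r, hIr d hd, hJr e he⟩
  refine ⟨tsup p q, ⟨{f | f ∈ KhatS D ∧ ∃ d ∈ I, ∃ e ∈ J, TLe f (tsup d e)}, ⟨?_, ?_, ?_, ?_⟩, ?_⟩,
    aux_le_left _ _, aux_le_right hpr hqr, fun r' _ h1 h2 => aux_sup_le h1 h2⟩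
  · exact fun f hf => hf.1
  · exact ⟨tsup i0 j0, hK _ hi0 _ hj0, i0, hi0, j0, hj0, fun _ _ h => h⟩
  · rintro f ⟨-, d, hd, e, he, hf⟩ f' ⟨-, d', hd', e', he', hf'⟩
    obtain ⟨d2, hd2, a1, a2⟩ := hId d hd d' hd'
    obtain ⟨e2, he2, b1, b2⟩ := hJd e he e' he'
    have l := aux_le_left d2 e2
    have rr := aux_le_right (hIr _ hd2) (hJr _ he2)
    exact ⟨tsup d2 e2, ⟨hK _ hd2 _ he2, d2, hd2, e2, he2, fun _ _ h => h⟩,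
      aux_trans hf (aux_sup_le (aux_trans a1 l) (aux_trans b1 rr)),
      aux_trans hf' (aux_sup_le (aux_trans a2 l) (aux_trans b2 rr))⟩
  · rintro d hd e ⟨-, d', hd', e', he', hf⟩ hde
    exact ⟨hd, d', hd', e', he', aux_trans hde hf⟩
  · intro k b
    constructor
    · intro h
      unfold tsup at h
      split_ifs at h
      · obtain ⟨e, he, hek⟩ := (hJs k b).1 h
        exact ⟨tsup i0 e, ⟨hK _ hi0 _ he, i0, hi0, e, he, fun _ _ h => h⟩,
          aux_le_right (hIr _ hi0) (hJr _ he) k b hek⟩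
      · obtain ⟨e, he, hek⟩ := (hIs k b).1 h
        exact ⟨tsup e j0, ⟨hK _ he _ hj0, e, he, j0, hj0, fun _ _ h => h⟩,
          aux_le_left _ _ k b hek⟩
    · rintro ⟨f, ⟨-, d, hd, e, he, hf⟩, hfk⟩
      exact aux_trans hf (aux_sup_le (aux_trans (hIp d hd) (aux_le_left _ _))
        (aux_trans (hJq e he) (aux_le_right hpr hqr))) k b hfk
end

section
/- Let S be a proper dyadic subbase of X. For p ∈ 𝕋^ω the set {e ∈ K̂_S : e ⊑ p} is directed; let φ(p) be its least upper bound in 𝕋^ω. Then φ is a well-defined map from 𝕋^ω into D̂_S which is continuous (equivalently, Scott continuous), φ(x̃) = x̃ for every x ∈ X, and for every p ∈ ↑X̃ one has φ(p) ∈ ↑X̃ ∩ D̂_S and ρ_S(φ(p)) = ρ_S(p). (Reduction map constructed in the proof of Proposition 4.5) -/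
open Set Topology TopologicalSpace

variable {X : Type*} [TopologicalSpace X]

theorem aux_trunc_le (p : ℕ → TT) (n : ℕ) : TLe (trunc p n) p := by
  intro k b h
  unfold trunc at h
  split_ifs at h
  exact h

theorem aux_trans_s9 {p q r : ℕ → TT} (h : TLe p q) (h' : TLe q r) : TLe p r :=
  fun k b hk => h' k b (h k b hk)

theorem aux_open_digit (b : Bool) : IsOpen ({TT.digit b} : Set TT) := by
  apply TopologicalSpace.isOpen_generateFrom_of_mem
  cases b <;> simp

theorem aux_dir {X : Type*} [TopologicalSpace X] (D : DyadicSubbase X) (p q r : ℕ → TT)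
    (hr : r ∈ upX D) (m n : ℕ) (hmn : m ≤ n)
    (hd : TLe (trunc q m) p) (he : TLe (trunc r n) p) :
    ∃ f ∈ KhatS D, TLe f p ∧ TLe (trunc q m) f ∧ TLe (trunc r n) f := by
  obtain ⟨x, hx⟩ := hr
  have hef : TLe (trunc r n) (tsup (trunc q m) (trunc r n)) := by
    intro k b hk
    unfold tsup
    split_ifs with h
    · exact hk
    · have h1 := he k b hk
      cases h2 : trunc q m k with
      | bot => exact absurd h2 h
      | digit c => rw [← hd k c h2, h1]
  refine ⟨tsup (trunc q m) (trunc r n),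
    ⟨fun k => if k < n then tsup (trunc q m) (trunc r n) k else r k, ⟨x, ?_⟩, n, ?_⟩, ?_, ?_, hef⟩
  · intro k b hk
    have h1 := hx k b hk
    by_cases h : k < n
    · simp only [h, if_true]
      apply hef
      simp [trunc, h, h1]
    · simp [h, h1]
  · funext k
    by_cases h : k < n
    · simp [trunc, h]
    · have : ¬ k < m := by omega
      simp [trunc, tsup, h, this]
  · intro k b hk
    unfold tsup at hk
    split_ifs at hk with h
    · exact he k b hk
    · exact hd k b hk
  · intro k b hk
    simp [tsup, hk]

theorem aux_open_up (q : ℕ → TT) (n : ℕ) : IsOpen {p : ℕ → TT | TLe (trunc q n) p} := by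
  have : {p : ℕ → TT | TLe (trunc q n) p} =
      ⋂ k ∈ Set.Iio n, {p : ℕ → TT | ∀ b, q k = TT.digit b → p k = TT.digit b} := by
    ext p
    simp only [Set.mem_setOf_eq, Set.mem_iInter, Set.mem_Iio]
    constructor
    · intro h k hk b hb
      exact h k b (by simp [trunc, hk, hb])
    · intro h k b hb
      unfold trunc at hb
      split_ifs at hb with hk
      exact h k hk b hb
  rw [this]
  apply (Set.finite_Iio n).isOpen_biInter
  intro k _
  cases hq : q k with
  | bot => simp
  | digit c =>
    have : {p : ℕ → TT | ∀ b, TT.digit c = TT.digit b → p k = TT.digit b} =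
        (fun p : ℕ → TT => p k) ⁻¹' {TT.digit c} := by
      ext p
      simp
    rw [this]
    exact (aux_open_digit c).preimage (continuous_apply k)

theorem aux_anti {p q : ℕ → TT} (h : TLe p q) (h' : TLe q p) : p = q := by
  funext k
  cases hp : p k with
  | digit b => exact (h k b hp).symm
  | bot =>
    cases hq : q k with
    | bot => rfl
    | digit b => exact absurd (h' k b hq) (by simp [hp])

/-- The reduction map of Proposition 4.5: for every p, {e ∈ K̂_S : e ⊑ p} is
directed, and φ(p) = ⊔{e ∈ K̂_S : e ⊑ p} is a well-defined continuous map into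
D̂_S fixing X̃ and preserving ρ_S on ↑X̃. -/
theorem stmt_9 {X : Type*} [TopologicalSpace X] [T2Space X] [SecondCountableTopology X]
    [Nonempty X] (D : DyadicSubbase X) (hD : IsProperDS D)
    (ρ : (ℕ → TT) → X) (hρ : ∀ p ∈ upX D, SbarInt D p = {ρ p})
    (ϕ : (ℕ → TT) → (ℕ → TT))
    (hϕ : ∀ p, IsSupOf {e ∈ KhatS D | TLe e p} (ϕ p)) :
    (∀ p : ℕ → TT, ∃ e ∈ KhatS D, TLe e p) ∧
    (∀ p : ℕ → TT, ∀ d ∈ KhatS D, TLe d p → ∀ e ∈ KhatS D, TLe e p →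
      ∃ f ∈ KhatS D, TLe f p ∧ TLe d f ∧ TLe e f) ∧
    (∀ p, ϕ p ∈ DhatS D) ∧
    Continuous ϕ ∧
    (∀ x : X, ϕ (phi D x) = phi D x) ∧
    (∀ p ∈ upX D, ϕ p ∈ upX D ∩ DhatS D ∧ ρ (ϕ p) = ρ p) := by
  have h1 : ∀ p : ℕ → TT, ∃ e ∈ KhatS D, TLe e p := by
    intro p
    obtain ⟨x⟩ := ‹Nonempty X›
    exact ⟨trunc (phi D x) 0, ⟨phi D x, ⟨x, fun _ _ h => h⟩, 0, rfl⟩,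
      fun k b h => by simp [trunc] at h⟩
  have h2 : ∀ p : ℕ → TT, ∀ d ∈ KhatS D, TLe d p → ∀ e ∈ KhatS D, TLe e p →
      ∃ f ∈ KhatS D, TLe f p ∧ TLe d f ∧ TLe e f := by
    rintro p d ⟨q, hq, m, rfl⟩ hd e ⟨r, hr, n, rfl⟩ he
    rcases le_total m n with h | h
    · exact aux_dir D p q r hr m n h hd he
    · obtain ⟨f, a, b, c, d⟩ := aux_dir D p r q hq n m h he hd
      exact ⟨f, a, b, d, c⟩
  have h3 : ∀ p, ϕ p ∈ DhatS D := by
    intro p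
    refine ⟨_, ⟨fun e he => he.1, ?_, ?_, ?_⟩, hϕ p⟩
    · obtain ⟨e, he, hp⟩ := h1 p
      exact ⟨e, he, hp⟩
    · rintro d ⟨hd, hd'⟩ e ⟨he, he'⟩
      obtain ⟨f, a, b, c⟩ := h2 p d hd hd' e he he'
      exact ⟨f, ⟨a, b⟩, c⟩
    · rintro d hd e ⟨_, he⟩ hde
      exact ⟨hd, aux_trans_s9 hde he⟩
  have hle : ∀ p, TLe (ϕ p) p := by
    intro p k b hk
    obtain ⟨e, he, hek⟩ := (hϕ p k b).1 hk
    exact he.2 k b hek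
  have hge : ∀ x p, TLe (phi D x) p → TLe (phi D x) (ϕ p) := by
    intro x p hx k b hk
    refine (hϕ p k b).2 ⟨trunc (phi D x) (k+1),
      ⟨⟨phi D x, ⟨x, fun _ _ h => h⟩, k+1, rfl⟩, aux_trans_s9 (aux_trunc_le _ _) hx⟩, ?_⟩
    simp [trunc, hk]
  refine ⟨h1, h2, h3, ?_, ?_, ?_⟩
  · refine continuous_pi fun k => continuous_generateFrom_iff.2 ?_
    have key : ∀ b, IsOpen ((fun p => ϕ p k) ⁻¹' {TT.digit b}) := by
      intro b
      have : (fun p => ϕ p k) ⁻¹' {TT.digit b} =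
          ⋃ e ∈ {e ∈ KhatS D | e k = TT.digit b}, {p | TLe e p} := by
        ext p
        simp only [Set.mem_preimage, Set.mem_singleton_iff, Set.mem_iUnion, Set.mem_setOf_eq,
          exists_prop]
        rw [hϕ p k b]
        constructor
        · rintro ⟨e, ⟨a, b⟩, c⟩
          exact ⟨e, ⟨a, c⟩, b⟩
        · rintro ⟨e, ⟨a, b⟩, c⟩
          exact ⟨e, ⟨a, c⟩, b⟩
      rw [this]
      refine isOpen_biUnion ?_
      rintro e ⟨⟨q, _, n, rfl⟩, _⟩
      exact aux_open_up q n
    rintro U (rfl | rfl)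
    · exact key false
    · exact key true
  · intro x
    exact aux_anti (hle _) (hge x _ (fun _ _ h => h))
  · intro p hp
    have hup : ϕ p ∈ upX D := by
      obtain ⟨x, hx⟩ := hp
      exact ⟨x, hge x p hx⟩
    refine ⟨⟨hup, h3 p⟩, ?_⟩
    have ha : ρ p ∈ SbarInt D p := by rw [hρ p hp]; rfl
    have hb : ρ p ∈ SbarInt D (ϕ p) := fun k b hk => ha k b (hle p k b hk)
    rw [hρ _ hup] at hb
    exact hb.symm
end

section
/- Let S be a proper dyadic subbase of X. Then D_S ∩ 2^ω = D̂_S ∩ 2^ω; that is, a sequence p ∈ 𝕋^ω with dom(p) = ℕ belongs to D_S if and only if it belongs to D̂_S. (Proposition 4.8) -/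
open Set Topology TopologicalSpace

variable {X : Type*} [TopologicalSpace X]

theorem phi_eq_of_mem (D : DyadicSubbase X) (x : X) (k : ℕ) (b : Bool) (h : x ∈ D.S k b) :
    phi D x k = TT.digit b := by
  cases b with
  | false => simp [phi, h]
  | true =>
    have h2 : x ∉ D.S k false := by
      intro h3
      rw [D.compl k] at h
      exact h (subset_closure h3)
    simp [phi, h, h2]

theorem mem_of_phi_eq (D : DyadicSubbase X) (x : X) (k : ℕ) (b : Bool)
    (h : phi D x k = TT.digit b) : x ∈ D.S k b := by
  unfold phi at h
  split_ifs at h with h1 h2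
  · cases h
    exact h1
  · cases h
    exact h2

theorem mem_closure_of_le (D : DyadicSubbase X) (x : X) (q : ℕ → TT) (hq : TLe (phi D x) q)
    (k : ℕ) (b : Bool) (h : q k = TT.digit b) : x ∈ closure (D.S k b) := by
  by_cases hb : x ∈ D.S k b
  · exact subset_closure hb
  have hnb : x ∉ D.S k (!b) := by
    intro h1
    have h2 := hq k _ (phi_eq_of_mem D x k _ h1)
    rw [h] at h2
    cases b <;> simp at h2
  cases b with
  | false =>
    have h1 : x ∉ D.S k true := hnb
    rw [D.compl k] at h1
    exact not_not.mp h1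
  | true =>
    have h1 : x ∉ D.S k false := hnb
    rw [D.regOpen k false, interior_eq_compl_closure_compl, ← D.compl k] at h1
    exact not_not.mp h1

theorem trunc_digit (p : ℕ → TT) (n k : ℕ) (b : Bool) :
    trunc p n k = TT.digit b ↔ k < n ∧ p k = TT.digit b := by
  unfold trunc
  split_ifs with h <;> simp [h]

theorem tFin_trunc (p : ℕ → TT) (n : ℕ) : TFin (trunc p n) := by
  refine (Set.finite_lt_nat n).subset ?_
  intro k hk
  by_contra h
  apply hk
  have h' : ¬ k < n := h
  simp [trunc, h']

theorem sint_nonempty_of_Khat (D : DyadicSubbase X) (hD : IsProperDS D) (e : ℕ → TT)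
    (he : e ∈ KhatS D) : (Sint D e).Nonempty := by
  obtain ⟨q, ⟨x, hx⟩, m, rfl⟩ := he
  rw [← closure_nonempty_iff, hD _ (tFin_trunc q m)]
  exact ⟨x, fun k b h => mem_closure_of_le D x q hx k b ((trunc_digit _ _ _ _).1 h).2⟩

theorem KS_subset_Khat (D : DyadicSubbase X) : KS D ⊆ KhatS D := by
  rintro e ⟨x, m, rfl⟩
  exact ⟨phi D x, ⟨x, fun _ _ h => h⟩, m, rfl⟩

theorem main_iff (D : DyadicSubbase X) (hD : IsProperDS D) (K : Set (ℕ → TT))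
    (h1 : KS D ⊆ K) (h2 : K ⊆ KhatS D) (p : ℕ → TT) (hp : p ∈ twoOmega) :
    (∃ I, IsIdealOf K I ∧ IsSupOf I p) ↔ ∀ n, (Sint D (trunc p n)).Nonempty := by
  constructor
  · rintro ⟨I, ⟨hIK, hne, hdir, -⟩, hsup⟩ n
    have key : ∃ e ∈ I, TLe (trunc p n) e := by
      induction n with
      | zero =>
        obtain ⟨e, he⟩ := hne
        refine ⟨e, he, fun k b h => ?_⟩
        rw [trunc_digit] at h
        omega
      | succ n ih =>
        obtain ⟨e, he, hle⟩ := ih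
        cases hpn : p n with
        | bot => exact absurd hpn (hp n)
        | digit c =>
          obtain ⟨e', he', hc⟩ := (hsup n c).1 hpn
          obtain ⟨f, hf, hef, hef'⟩ := hdir e he e' he'
          refine ⟨f, hf, fun k b h => ?_⟩
          rw [trunc_digit] at h
          rcases Nat.lt_succ_iff_lt_or_eq.1 h.1 with hk | rfl
          · exact hef k b (hle k b ((trunc_digit _ _ _ _).2 ⟨hk, h.2⟩))
          · have : b = c := by
              have := h.2.symm.trans hpn
              simpa using this
            subst this
            exact hef' k b hc
    obtain ⟨e, he, hle⟩ := key
    obtain ⟨x, hx⟩ := sint_nonempty_of_Khat D hD e (h2 (hIK he))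
    exact ⟨x, fun k b h => hx k b (hle k b h)⟩
  · intro h
    have hmem : ∀ n, trunc p n ∈ K := by
      intro n
      obtain ⟨x, hx⟩ := h n
      apply h1
      refine ⟨x, n, ?_⟩
      funext k
      unfold trunc
      split_ifs with hk
      · cases hpk : p k with
        | bot => exact absurd hpk (hp k)
        | digit c =>
          exact (phi_eq_of_mem D x k c (hx k c ((trunc_digit _ _ _ _).2 ⟨hk, hpk⟩))).symm
      · rfl
    have hmono : ∀ m n, m ≤ n → TLe (trunc p m) (trunc p n) := by
      intro m n hmn k b hk
      rw [trunc_digit] at hk ⊢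
      exact ⟨by omega, hk.2⟩
    refine ⟨{d | d ∈ K ∧ ∃ n, TLe d (trunc p n)},
      ⟨fun d hd => hd.1, ⟨trunc p 0, hmem 0, 0, fun _ _ h => h⟩, ?_, ?_⟩, ?_⟩
    · rintro d ⟨-, m, hm⟩ e ⟨-, n, hn⟩
      refine ⟨trunc p (max m n), ⟨hmem _, _, fun _ _ h => h⟩, ?_, ?_⟩
      · exact fun k b h => hmono m _ (le_max_left _ _) k b (hm k b h)
      · exact fun k b h => hmono n _ (le_max_right _ _) k b (hn k b h)
    · rintro d hd e ⟨-, n, hn⟩ hde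
      exact ⟨hd, n, fun k b h => hn k b (hde k b h)⟩
    · intro k b
      constructor
      · intro hk
        exact ⟨trunc p (k+1), ⟨hmem _, _, fun _ _ h => h⟩,
          (trunc_digit _ _ _ _).2 ⟨by omega, hk⟩⟩
      · rintro ⟨e, ⟨-, n, hn⟩, hk⟩
        exact ((trunc_digit _ _ _ _).1 (hn k b hk)).2

/-- Proposition 4.8: D_S ∩ 2^ω = D̂_S ∩ 2^ω. -/
theorem stmt_11 {X : Type*} [TopologicalSpace X] [T2Space X] [SecondCountableTopology X]
    (D : DyadicSubbase X) (hD : IsProperDS D) :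
    DS D ∩ twoOmega = DhatS D ∩ twoOmega := by
  ext p
  constructor
  · rintro ⟨h, hp⟩
    exact ⟨(main_iff D hD _ (KS_subset_Khat D) subset_rfl p hp).2
      ((main_iff D hD _ subset_rfl (KS_subset_Khat D) p hp).1 h), hp⟩
  · rintro ⟨h, hp⟩
    exact ⟨(main_iff D hD _ subset_rfl (KS_subset_Khat D) p hp).2
      ((main_iff D hD _ (KS_subset_Khat D) subset_rfl p hp).1 h), hp⟩
end

section
/- Suppose X is an adhesive space and S is a proper dyadic subbase of X such that S_{n,a} ≠ ∅ for every n ∈ ℕ and a ∈ {0,1}. Then the least element ⊥^ω (the everywhere-⊥ sequence) of the poset K_S has infinitely many immediate successors in K_S. (Proposition 5.8) -/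
open Set Topology TopologicalSpace

variable {X : Type*} [TopologicalSpace X]

lemma aux_open {X : Type*} [TopologicalSpace X] (D : DyadicSubbase X) (n : ℕ) (a : Bool) :
    IsOpen (D.S n a) := by
  rw [D.regOpen n a]; exact isOpen_interior

lemma aux_fin (b : Bool) (n : ℕ) : TFin (trunc (fun _ => TT.digit b) n) := by
  refine (Set.finite_Iio n).subset ?_
  intro k hk
  by_contra h
  exact hk (by simp only [Set.mem_Iio] at h; simp [trunc, h])

lemma aux_Sint {X : Type*} [TopologicalSpace X] (D : DyadicSubbase X) (b : Bool) (n : ℕ) :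
    Sint D (trunc (fun _ => TT.digit b) n) = ⋂ k ∈ Set.Iio n, D.S k b := by
  ext x
  simp only [Sint, trunc, Set.mem_setOf_eq, Set.mem_iInter, Set.mem_Iio]
  constructor
  · intro h k hk
    exact h k b (by simp [hk])
  · intro h k c hc
    by_cases hk : k < n
    · simp [hk] at hc
      subst hc
      exact h k hk
    · simp [hk] at hc

lemma aux_Sbar {X : Type*} [TopologicalSpace X] (D : DyadicSubbase X) (b : Bool) (n : ℕ) :
    SbarInt D (trunc (fun _ => TT.digit b) n) = ⋂ k ∈ Set.Iio n, closure (D.S k b) := by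
  ext x
  simp only [SbarInt, trunc, Set.mem_setOf_eq, Set.mem_iInter, Set.mem_Iio]
  constructor
  · intro h k hk
    exact h k b (by simp [hk])
  · intro h k c hc
    by_cases hk : k < n
    · simp [hk] at hc
      subst hc
      exact h k hk
    · simp [hk] at hc

lemma aux_bot {X : Type*} [TopologicalSpace X] (D : DyadicSubbase X) (x : X) (k : ℕ)
    (h0 : x ∈ closure (D.S k false)) (h1 : x ∈ closure (D.S k true)) : phi D x k = TT.bot := by
  have a1 : x ∉ D.S k true := by rw [D.compl k]; exact fun h => h h0
  have a0 : x ∉ D.S k false := by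
    intro h
    obtain ⟨y, hy0, hy1⟩ := mem_closure_iff.1 h1 _ (aux_open D k false) h
    rw [D.compl k] at hy1
    exact hy1 (subset_closure hy0)
  simp [phi, a0, a1]

lemma aux_notbot {X : Type*} [TopologicalSpace X] [T2Space X] (D : DyadicSubbase X)
    (hX : ∃ y z : X, y ≠ z) (x : X) : ∃ n, phi D x n ≠ TT.bot := by
  by_contra! hall
  have hS : ∀ n a, x ∉ D.S n a := by
    intro n a h
    have := hall n
    unfold phi at this
    cases a <;> split_ifs at this <;> simp_all
  have key : ∀ U : Set X, GenerateOpen {U | ∃ n a, U = D.S n a} U → x ∈ U → U = Set.univ := by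
    intro U hU
    induction hU with
    | basic s hs =>
      obtain ⟨n, a, rfl⟩ := hs
      exact fun h => absurd h (hS n a)
    | univ => exact fun _ => rfl
    | inter s t _ _ h1 h2 => intro h; rw [h1 h.1, h2 h.2, Set.inter_self]
    | sUnion T _ ih =>
      rintro ⟨s, hs, hx⟩
      have := ih s hs hx
      exact Set.eq_univ_of_univ_subset (this ▸ Set.subset_sUnion_of_mem hs)
  obtain ⟨y, hy⟩ : ∃ y, x ≠ y := by
    obtain ⟨y, z, hyz⟩ := hX
    by_cases h : x = y
    · exact ⟨z, h ▸ hyz⟩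
    · exact ⟨y, h⟩
  obtain ⟨U, V, hU, hV, hxU, hyV, hd⟩ := t2_separation hy
  have hU' : IsOpen[generateFrom {U | ∃ n a, U = D.S n a}] U := by rw [D.subbase]; exact hU
  have := key U hU' hxU
  subst this
  exact Set.disjoint_left.1 hd (Set.mem_univ y) hyV

theorem stmt_12 {X : Type*} [TopologicalSpace X] [T2Space X] [SecondCountableTopology X]
    (D : DyadicSubbase X) (hD : IsProperDS D) (hX : Adhesive X)
    (hne : ∀ n (a : Bool), (D.S n a).Nonempty) :
    {q | ImmSucc (KS D) (fun _ => TT.bot) q}.Infinite := by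
  obtain ⟨h2, hadh⟩ := hX
  have hcl : ∀ b n, closure (⋂ k ∈ Set.Iio n, D.S k b) = ⋂ k ∈ Set.Iio n, closure (D.S k b) := by
    intro b n
    rw [← aux_Sint, ← aux_Sbar]
    exact hD _ (aux_fin b n)
  have hop : ∀ b n, IsOpen (⋂ k ∈ Set.Iio n, D.S k b) := fun b n =>
    (Set.finite_Iio n).isOpen_biInter fun k _ => aux_open D k b
  have hnon : ∀ b n, (⋂ k ∈ Set.Iio n, D.S k b).Nonempty := by
    intro b n
    induction n with
    | zero => obtain ⟨y, -⟩ := h2; exact ⟨y, by simp⟩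
    | succ n ih =>
      obtain ⟨x, hx1, hx2⟩ := hadh _ _ (hop b n) (aux_open D n b) ih (hne n b)
      rw [hcl] at hx1
      rw [← closure_nonempty_iff, hcl]
      refine ⟨x, ?_⟩
      simp only [Set.mem_iInter, Set.mem_Iio] at hx1 ⊢
      intro k hk
      rcases Nat.lt_succ_iff_lt_or_eq.1 hk with h | rfl
      · exact hx1 k h
      · exact hx2
  have hbot : ∀ N, ∃ x, ∀ k < N, phi D x k = TT.bot := by
    intro N
    obtain ⟨x, h0, h1⟩ := hadh _ _ (hop false N) (hop true N) (hnon _ _) (hnon _ _)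
    rw [hcl] at h0 h1
    simp only [Set.mem_iInter, Set.mem_Iio] at h0 h1
    exact ⟨x, fun k hk => aux_bot D x k (h0 k hk) (h1 k hk)⟩
  intro hfin
  refine Set.infinite_of_forall_exists_gt (s := (fun q => sInf (Tdom q)) ''
    {q | ImmSucc (KS D) (fun _ => TT.bot) q}) ?_ (hfin.image _)
  intro N
  obtain ⟨x, hx⟩ := hbot (N + 1)
  classical
  have hex := aux_notbot D h2 x
  obtain ⟨n, hn, hmin⟩ : ∃ n, phi D x n ≠ TT.bot ∧ ∀ k < n, phi D x k = TT.bot :=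
    ⟨Nat.find hex, Nat.find_spec hex, fun k hk => not_not.1 (Nat.find_min hex hk)⟩
  have hNn : N < n := by
    by_contra h
    exact hn (hx n (by omega))
  have hq : ∀ k, k ≠ n → trunc (phi D x) (n + 1) k = TT.bot := by
    intro k hk
    unfold trunc
    split_ifs with h
    · exact hmin k (by omega)
    · rfl
  have hqn : trunc (phi D x) (n + 1) n = phi D x n := by simp [trunc]
  have hdom : Tdom (trunc (phi D x) (n + 1)) = {n} := by
    ext k
    simp only [Tdom, Set.mem_setOf_eq, Set.mem_singleton_iff]
    constructor
    · intro h; by_contra h'; exact h (hq k h')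
    · rintro rfl; rwa [hqn]
  refine ⟨n, ⟨trunc (phi D x) (n + 1), ⟨⟨x, 0, ?_⟩, ⟨x, n + 1, rfl⟩, ?_, ?_, ?_⟩, ?_⟩, hNn⟩
  · funext k; simp [trunc]
  · intro k b h; cases h
  · intro h; exact hn (by rw [← hqn, ← h])
  · rintro ⟨r, -, -, hr1, hr2, hr3⟩
    have hrk : ∀ k, k ≠ n → r k = TT.bot := by
      intro k hk
      cases hc : r k with
      | bot => rfl
      | digit b => have := hr2 k b hc; rw [hq k hk] at this; cases this
    cases hc : r n with
    | bot =>
      apply hr1; funext k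
      by_cases hk : k = n
      · rw [hk, hc]
      · rw [hrk k hk]
    | digit b =>
      apply hr3; funext k
      by_cases hk : k = n
      · rw [hk, hc, hr2 n b hc]
      · rw [hrk k hk, hq k hk]
  · simp [hdom]
end

section
/- Suppose X is a nonadhesive space and S is a proper dyadic subbase of X. Then the least element ⊥^ω (the everywhere-⊥ sequence) of the poset K_S has only finitely many immediate successors in K_S. (Proposition 5.9) -/
open Set Topology TopologicalSpace

variable {X : Type*} [TopologicalSpace X]

theorem aux_phi_iff {X : Type*} [TopologicalSpace X] (D : DyadicSubbase X) (x : X) (n : ℕ)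
    (b : Bool) : phi D x n = TT.digit b ↔ x ∈ D.S n b := by
  have h : x ∈ D.S n true → x ∉ D.S n false := by
    intro h h'
    rw [D.compl] at h
    exact h (subset_closure h')
  unfold phi
  cases b <;> by_cases h1 : x ∈ D.S n false <;> by_cases h2 : x ∈ D.S n true <;> simp_all

theorem aux_bot_s13 {X : Type*} [TopologicalSpace X] (D : DyadicSubbase X) (x : X) (n : ℕ)
    (h : phi D x n = TT.bot) (b : Bool) : x ∈ closure (D.S n b) := by
  have h0 : x ∉ D.S n false := by
    intro hh
    rw [← aux_phi_iff, h] at hh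
    cases hh
  have h1 : x ∉ D.S n true := by
    intro hh
    rw [← aux_phi_iff, h] at hh
    cases hh
  cases b
  · by_contra hc
    exact h1 (by rw [D.compl]; exact hc)
  · rw [D.compl, closure_compl, ← D.regOpen]
    exact h0

theorem aux_nbhd {X : Type*} [t : TopologicalSpace X] (D : DyadicSubbase X) (x : X) (U : Set X)
    (hU : IsOpen U) (hx : x ∈ U) : ∃ n, ∀ m, n ≤ m → Sint D (trunc (phi D x) m) ⊆ U := by
  have hU' : GenerateOpen {U | ∃ n a, U = D.S n a} U := by
    have := hU
    rw [← D.subbase] at this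
    exact this
  clear hU
  induction hU' with
  | basic s hs =>
    obtain ⟨n, a, rfl⟩ := hs
    refine ⟨n + 1, fun m hm y hy => hy n a ?_⟩
    have : n < m := hm
    simp [trunc, this, aux_phi_iff, hx]
  | univ => exact ⟨0, fun _ _ => subset_univ _⟩
  | inter s t _ _ ih1 ih2 =>
    obtain ⟨n, hn⟩ := ih1 hx.1
    obtain ⟨k, hk⟩ := ih2 hx.2
    exact ⟨max n k, fun m hm => subset_inter (hn m (by omega)) (hk m (by omega))⟩
  | sUnion S _ ih =>
    obtain ⟨s, hs, hxs⟩ := hx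
    obtain ⟨n, hn⟩ := ih s hs hxs
    exact ⟨n, fun m hm => (hn m hm).trans (subset_sUnion_of_mem hs)⟩

theorem aux_closure {X : Type*} [TopologicalSpace X] (D : DyadicSubbase X) (hD : IsProperDS D)
    (x : X) (U : Set X) (hU : IsOpen U) (hx : x ∈ U) :
    ∃ n, ∀ m, n ≤ m → ∀ y, (∀ j < m, phi D y j = TT.bot) → y ∈ closure U := by
  obtain ⟨n, hn⟩ := aux_nbhd D x U hU hx
  refine ⟨n, fun m hm y hy => closure_mono (hn m hm) ?_⟩
  rw [hD]
  · intro k b hk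
    apply aux_bot_s13
    apply hy
    by_contra hc
    simp [trunc, hc] at hk
  · refine (Set.finite_Iio m).subset fun k hk => ?_
    by_contra hc
    simp only [mem_Iio] at hc
    simp [Tdom, trunc, hc] at hk

theorem aux_succ {X : Type*} [TopologicalSpace X] (D : DyadicSubbase X) (q : ℕ → TT)
    (h : ImmSucc (KS D) (fun _ => TT.bot) q) :
    ∃ x k b, q = (fun j => if j = k then TT.digit b else TT.bot) ∧ phi D x k = TT.digit b ∧
      ∀ j < k, phi D x j = TT.bot := by
  classical
  obtain ⟨-, ⟨x, m, rfl⟩, -, hne, hno⟩ := h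
  have hex : ∃ k, trunc (phi D x) m k ≠ TT.bot := by
    by_contra hc
    push Not at hc
    exact hne (funext fun k => (hc k).symm)
  have hk := Nat.find_spec hex
  have hmin : ∀ j < Nat.find hex, trunc (phi D x) m j = TT.bot := fun j hj => by
    simpa using Nat.find_min hex hj
  generalize Nat.find hex = k at hk hmin
  have hkm : k < m := by
    by_contra hc
    simp [trunc, hc] at hk
  have hlt : ∀ j < k, phi D x j = TT.bot := fun j hj => by
    simpa [trunc, hj.trans hkm] using hmin j hj
  have hk' : phi D x k ≠ TT.bot := by simpa [trunc, hkm] using hk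
  obtain ⟨b, hb⟩ : ∃ b, phi D x k = TT.digit b := by
    cases hp : phi D x k with
    | bot => exact absurd hp hk'
    | digit b => exact ⟨b, rfl⟩
  refine ⟨x, k, b, ?_, hb, hlt⟩
  have heq : trunc (phi D x) (k + 1) = trunc (phi D x) m := by
    by_contra hc
    refine hno ⟨_, ⟨x, k + 1, rfl⟩, ?_, ?_, ?_, hc⟩
    · intro j c hj
      cases hj
    · intro he
      have := congrFun he k
      simp [trunc, hb] at this
    · intro j c hj
      by_cases hjk : j < k + 1
      · have : j < m := by omega
        simpa [trunc, hjk, this] using hj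
      · simp [trunc, hjk] at hj
  rw [← heq]
  funext j
  rcases lt_trichotomy j k with hj | hj | hj
  · simp [trunc, hj.ne, hlt j hj]
  · subst hj
    simp [trunc, hb]
  · have : ¬ j < k + 1 := by omega
    simp [trunc, this, hj.ne']

/-- Proposition 5.9: if X is nonadhesive and S is a proper dyadic subbase,
then ⊥^ω has only finitely many immediate successors in K_S. -/
theorem stmt_13 {X : Type*} [TopologicalSpace X] [T2Space X] [SecondCountableTopology X]
    (D : DyadicSubbase X) (hD : IsProperDS D) (hX : ¬ Adhesive X) :
    {q | ImmSucc (KS D) (fun _ => TT.bot) q}.Finite := by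
  classical
  by_contra hinf
  have key : ∀ N, ∃ x, ∀ j < N, phi D x j = TT.bot := by
    intro N
    by_contra hc
    apply hinf
    refine (((Set.finite_Iio N).prod (Set.finite_univ (α := Bool))).image
      (fun p : ℕ × Bool => fun j => if j = p.1 then TT.digit p.2 else TT.bot)).subset ?_
    intro q hq
    obtain ⟨x, k, b, rfl, -, hlt⟩ := aux_succ D q hq
    refine ⟨(k, b), ⟨?_, mem_univ _⟩, rfl⟩
    by_contra hk
    simp only [mem_Iio, not_lt] at hk
    exact hc ⟨x, fun j hj => hlt j (hj.trans_le hk)⟩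
  obtain ⟨q, hq⟩ := Set.Infinite.nonempty hinf
  obtain ⟨x, k, b, -, hb, -⟩ := aux_succ D q hq
  apply hX
  refine ⟨?_, ?_⟩
  · obtain ⟨y, hy⟩ := key (k + 1)
    refine ⟨x, y, ?_⟩
    rintro rfl
    rw [hy k (Nat.lt_succ_self k)] at hb
    cases hb
  · rintro U V hU hV ⟨u, hu⟩ ⟨v, hv⟩
    obtain ⟨n, hn⟩ := aux_closure D hD u U hU hu
    obtain ⟨m, hm⟩ := aux_closure D hD v V hV hv
    obtain ⟨y, hy⟩ := key (max n m)
    exact ⟨y, hn _ (le_max_left _ _) y hy, hm _ (le_max_right _ _) y hy⟩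
end
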